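/- For every natural number k, every real φ, and every real s with |s| < 1, the k-th derivative with respect to s of the function s ↦ ∫₀^φ (1 − s·sin²τ)^(−1/2) dτ equals ((2k)!/(2^{2k} · k!)) · ∫₀^φ (1 − s·sin²τ)^(−1/2 − k) · sin^{2k}τ dτ. -/

import Mathlib

open Real MeasureTheory intervalIntegral

lemma one_sub_mul_sin_sq_pos {s : ℝ} (hs : |s| < 1) (τ : ℝ) : 0 < 1 - s * Real.sin τ ^ 2 := by
  have h := mul_le_mul_of_nonneg_right (le_abs_self s) (sq_nonneg (Real.sin τ))
  have h' := mul_le_of_le_one_right (abs_nonneg s) (Real.sin_sq_le_one τ)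
  linarith

lemma continuous_one_sub_mul_sin_sq_rpow_mul {s : ℝ} (hs : |s| < 1) (p : ℝ) (n : ℕ) :
    Continuous fun τ : ℝ => (1 - s * Real.sin τ ^ 2) ^ p * Real.sin τ ^ n := by
  refine Continuous.mul (Continuous.rpow_const (by fun_prop) fun τ => ?_) (by fun_prop)
  exact Or.inl (one_sub_mul_sin_sq_pos hs τ).ne'

lemma rpow_le_rpow_add_rpow {a b y : ℝ} (ha : 0 < a) (hay : a ≤ y) (hyb : y ≤ b) (p : ℝ) :
    y ^ p ≤ a ^ p + b ^ p := by
  have hy := ha.trans_le hay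
  have hb := hy.trans_le hyb
  rcases le_total 0 p with hp | hp
  · linarith [Real.rpow_le_rpow hy.le hyb hp, Real.rpow_nonneg ha.le p]
  · linarith [Real.rpow_le_rpow_of_nonpos ha hay hp, Real.rpow_nonneg hb.le p]

lemma hasDerivAt_integral_one_sub_mul_sin_sq_rpow_mul (φ p : ℝ) (n : ℕ) {s : ℝ} (hs : |s| < 1) :
    HasDerivAt (fun s : ℝ => ∫ τ in (0:ℝ)..φ, (1 - s * Real.sin τ ^ 2) ^ p * Real.sin τ ^ n)
      (-p * ∫ τ in (0:ℝ)..φ, (1 - s * Real.sin τ ^ 2) ^ (p - 1) * Real.sin τ ^ (n + 2)) s := by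
  obtain ⟨R, hsR, hR⟩ := exists_between hs
  have hnhds : {x : ℝ | |x| < R} ∈ nhds s :=
    (isOpen_lt continuous_abs continuous_const).mem_nhds hsR
  rw [← intervalIntegral.integral_const_mul]
  refine (hasDerivAt_integral_of_dominated_loc_of_deriv_le
    (F' := fun x τ => -p * ((1 - x * Real.sin τ ^ 2) ^ (p - 1) * Real.sin τ ^ (n + 2)))
    (bound := fun _ => |p| * ((1 - R) ^ (p - 1) + 2 ^ (p - 1))) hnhds
    ?_ ?_ ?_ ?_ intervalIntegrable_const ?_).2
  · filter_upwards [hnhds] with x hx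
    exact (continuous_one_sub_mul_sin_sq_rpow_mul (hx.trans hR) p n).aestronglyMeasurable
  · exact (continuous_one_sub_mul_sin_sq_rpow_mul hs p n).intervalIntegrable _ _
  · exact (continuous_const.mul
      (continuous_one_sub_mul_sin_sq_rpow_mul hs (p - 1) (n + 2))).aestronglyMeasurable
  · refine Filter.Eventually.of_forall fun τ _ x (hx : |x| < R) => ?_
    have hpos := one_sub_mul_sin_sq_pos (hx.trans hR) τ
    obtain ⟨h1, h2⟩ := abs_lt.1 hx
    have hsq := sq_nonneg (Real.sin τ)
    have hsq1 := Real.sin_sq_le_one τ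
    have hle : (1 - x * Real.sin τ ^ 2) ^ (p - 1) ≤ (1 - R) ^ (p - 1) + 2 ^ (p - 1) :=
      rpow_le_rpow_add_rpow (by linarith) (by nlinarith) (by nlinarith) _
    have hpow : |Real.sin τ| ^ (n + 2) ≤ 1 := pow_le_one₀ (abs_nonneg _) (Real.abs_sin_le_one τ)
    rw [Real.norm_eq_abs, abs_mul, abs_neg, abs_mul, abs_pow,
      abs_of_nonneg (Real.rpow_nonneg hpos.le _)]
    refine mul_le_mul_of_nonneg_left ?_ (abs_nonneg p)
    exact (mul_le_of_le_one_right (Real.rpow_nonneg hpos.le _) hpow).trans hle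
  · refine Filter.Eventually.of_forall fun τ _ x (hx : |x| < R) => ?_
    have hpos := one_sub_mul_sin_sq_pos (hx.trans hR) τ
    have hlin : HasDerivAt (fun x : ℝ => 1 - x * Real.sin τ ^ 2) (-(Real.sin τ ^ 2)) x := by
      simpa using ((hasDerivAt_id x).mul_const (Real.sin τ ^ 2)).const_sub 1
    refine ((hlin.rpow_const (p := p) (Or.inl hpos.ne')).mul_const (Real.sin τ ^ n)).congr_deriv ?_
    ring

theorem iteratedDeriv_elliptic_integral (k : ℕ) (φ : ℝ) (s : ℝ) (hs : |s| < 1) :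
    iteratedDeriv k
        (fun s : ℝ => ∫ τ in (0:ℝ)..φ, (1 - s * Real.sin τ ^ 2) ^ (-(1:ℝ)/2)) s
      = ((Nat.factorial (2 * k) : ℝ) / (2 ^ (2 * k) * (Nat.factorial k : ℝ))) *
          ∫ τ in (0:ℝ)..φ,
            (1 - s * Real.sin τ ^ 2) ^ (-(1:ℝ)/2 - k) * Real.sin τ ^ (2 * k) := by
  induction k generalizing s with
  | zero => simp
  | succ k ih =>
    have hev : ∀ᶠ x : ℝ in nhds s, |x| < 1 :=
      (isOpen_lt continuous_abs continuous_const).mem_nhds hs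
    rw [iteratedDeriv_succ, Filter.EventuallyEq.deriv_eq (hev.mono ih),
      ((hasDerivAt_integral_one_sub_mul_sin_sq_rpow_mul φ (-(1:ℝ)/2 - k) (2 * k) hs).const_mul
        _).deriv, ← mul_assoc]
    have hexp : -(1:ℝ)/2 - k - 1 = -(1:ℝ)/2 - (k + 1 : ℕ) := by push_cast; ring
    rw [hexp, show 2 * (k + 1) = 2 * k + 2 by ring]
    congr 1
    have hk : (Nat.factorial k : ℝ) ≠ 0 := by positivity
    simp only [Nat.factorial_succ, Nat.cast_mul, Nat.cast_add, Nat.cast_one, Nat.cast_ofNat]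
    field_simp
    ring
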